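/- (AB-inaccessible maximal hidden CHSH for quasi-distillable states, conditional.) Assume the QSE conjecture in both forms: for every two-qubit state σ, (i) if ‖b(σ)‖ < 1 and ‖c_A(σ)‖ > 1/2 then B(σ) ≤ 1, and (ii) if ‖a(σ)‖ < 1 and ‖c_B(σ)‖ > 1/2 then B(σ) ≤ 1. Let 0 < p < 2/3 and ρ_QD(p) = p|Ψ⁻⟩⟨Ψ⁻| + (1−p)|00⟩⟨00|. Then for every invertible 2×2 matrix f_A with ‖a(ρ'_FA)‖ < 1 one has B(ρ'_FA) ≤ 1, and for every invertible 2×2 matrix f_B with ‖b(ρ'_FB)‖ < 1 one has B(ρ'_FB) ≤ 1; that is, neither Alice nor Bob acting alone can reveal any CHSH-inequality violation from ρ_QD(p). -/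

import Mathlib

open Matrix Kronecker Complex
open scoped ComplexOrder

noncomputable section

/-- 2×2 complex matrices (one qubit operators). -/
abbrev Mat2 := Matrix (Fin 2) (Fin 2) ℂ
/-- 4×4 complex matrices, indexed by ℂ²⊗ℂ² product indices (two qubit operators). -/
abbrev Mat4 := Matrix (Fin 2 × Fin 2) (Fin 2 × Fin 2) ℂ

/-- A two-qubit state: positive semidefinite with trace 1. -/
def IsState (ρ : Mat4) : Prop := ρ.PosSemidef ∧ ρ.trace = 1

/-- The Pauli matrices σ₁, σ₂, σ₃ (indexed by 0,1,2). -/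
def pauli : Fin 3 → Mat2 :=
  ![!![0, 1; 1, 0], !![0, -Complex.I; Complex.I, 0], !![1, 0; 0, -1]]

/-- Alice's Bloch vector: a_i = tr((σ_i ⊗ 𝟙)ρ). -/
def aVec (ρ : Mat4) : Fin 3 → ℝ := fun i => ((pauli i ⊗ₖ (1 : Mat2)) * ρ).trace.re
/-- Bob's Bloch vector: b_i = tr((𝟙 ⊗ σ_i)ρ). -/
def bVec (ρ : Mat4) : Fin 3 → ℝ := fun i => (((1 : Mat2) ⊗ₖ pauli i) * ρ).trace.re
/-- Correlation matrix: T_{ij} = tr((σ_i ⊗ σ_j)ρ). -/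
def Tmat (ρ : Mat4) : Matrix (Fin 3) (Fin 3) ℝ :=
  Matrix.of fun i j => ((pauli i ⊗ₖ pauli j) * ρ).trace.re

/-- Euclidean norm on ℝ³. -/
def norm3 (v : Fin 3 → ℝ) : ℝ := Real.sqrt (∑ i, v i ^ 2)

/-- Alice's quantum steering ellipsoid centre c_A = γ_b²(a − T b), γ_b² = 1/(1 − ‖b‖²). -/
def cA (ρ : Mat4) : Fin 3 → ℝ :=
  (1 - norm3 (bVec ρ) ^ 2)⁻¹ • (aVec ρ - Tmat ρ *ᵥ bVec ρ)
/-- Bob's quantum steering ellipsoid centre c_B = γ_a²(b − Tᵀ a), γ_a² = 1/(1 − ‖a‖²). -/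
def cB (ρ : Mat4) : Fin 3 → ℝ :=
  (1 - norm3 (aVec ρ) ^ 2)⁻¹ • (bVec ρ - (Tmat ρ)ᵀ *ᵥ aVec ρ)

/-- Alice's QSE matrix Q_A = γ_b²(T − a bᵀ)(𝟙₃ + γ_b² b bᵀ)(Tᵀ − b aᵀ). -/
def QA (ρ : Mat4) : Matrix (Fin 3) (Fin 3) ℝ :=
  (1 - norm3 (bVec ρ) ^ 2)⁻¹ •
    ((Tmat ρ - vecMulVec (aVec ρ) (bVec ρ)) *
      (1 + (1 - norm3 (bVec ρ) ^ 2)⁻¹ • vecMulVec (bVec ρ) (bVec ρ)) *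
      ((Tmat ρ)ᵀ - vecMulVec (bVec ρ) (aVec ρ)))

/-- Bob's QSE matrix Q_B = γ_a²(Tᵀ − b aᵀ)(𝟙₃ + γ_a² a aᵀ)(T − a bᵀ). -/
def QB (ρ : Mat4) : Matrix (Fin 3) (Fin 3) ℝ :=
  (1 - norm3 (aVec ρ) ^ 2)⁻¹ •
    (((Tmat ρ)ᵀ - vecMulVec (bVec ρ) (aVec ρ)) *
      (1 + (1 - norm3 (aVec ρ) ^ 2)⁻¹ • vecMulVec (aVec ρ) (aVec ρ)) *
      (Tmat ρ - vecMulVec (aVec ρ) (bVec ρ)))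

/-- The Alice-filtered state ρ'_FA = (f⊗𝟙)ρ(f⊗𝟙)† / tr[(f†f⊗𝟙)ρ]. -/
def filterA (ρ : Mat4) (f : Mat2) : Mat4 :=
  ((((fᴴ * f) ⊗ₖ (1 : Mat2)) * ρ).trace)⁻¹ • ((f ⊗ₖ (1 : Mat2)) * ρ * (f ⊗ₖ (1 : Mat2))ᴴ)

/-- The Bob-filtered state ρ'_FB = (𝟙⊗f)ρ(𝟙⊗f)† / tr[(𝟙⊗f†f)ρ]. -/
def filterB (ρ : Mat4) (f : Mat2) : Mat4 :=
  ((((1 : Mat2) ⊗ₖ (fᴴ * f)) * ρ).trace)⁻¹ • (((1 : Mat2) ⊗ₖ f) * ρ * ((1 : Mat2) ⊗ₖ f)ᴴ)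

/-- The two-sided filtered state (f_A⊗f_B)ρ(f_A⊗f_B)† / tr[(f_A†f_A ⊗ f_B†f_B)ρ]. -/
def filterAB (ρ : Mat4) (f g : Mat2) : Mat4 :=
  ((((fᴴ * f) ⊗ₖ (gᴴ * g)) * ρ).trace)⁻¹ • ((f ⊗ₖ g) * ρ * (f ⊗ₖ g)ᴴ)

/-- The qubit observable α·σ for α ∈ ℝ³. -/
def obs (α : Fin 3 → ℝ) : Mat2 := ∑ k, (α k : ℂ) • pauli k

/-- The expectation value ⟨A⊗B⟩_ρ = tr((A⊗B)ρ) (real for states/Hermitian observables). -/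
def expVal (ρ : Mat4) (A B : Mat2) : ℝ := ((A ⊗ₖ B) * ρ).trace.re

/-- The CHSH functional ½(⟨A¹B¹⟩+⟨A¹B²⟩+⟨A²B¹⟩−⟨A²B²⟩). -/
def chshVal (ρ : Mat4) (α1 α2 β1 β2 : Fin 3 → ℝ) : ℝ :=
  (expVal ρ (obs α1) (obs β1) + expVal ρ (obs α1) (obs β2)
    + expVal ρ (obs α2) (obs β1) - expVal ρ (obs α2) (obs β2)) / 2

/-- The maximal CHSH value B(ρ) over measurement directions (unit vectors in ℝ³). -/
def Bval (ρ : Mat4) : ℝ :=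
  sSup {x | ∃ α1 α2 β1 β2 : Fin 3 → ℝ, norm3 α1 = 1 ∧ norm3 α2 = 1 ∧
    norm3 β1 = 1 ∧ norm3 β2 = 1 ∧ x = chshVal ρ α1 α2 β1 β2}

/-- The F₃ functional (1/√3)Σᵢ tr((Aⁱ⊗σᵢ)ρ). -/
def f3Val (ρ : Mat4) (α : Fin 3 → Fin 3 → ℝ) : ℝ :=
  (∑ i, expVal ρ (obs (α i)) (pauli i)) / Real.sqrt 3

/-- The maximal F₃ value over measurement directions. -/
def F3val (ρ : Mat4) : ℝ :=
  sSup {x | ∃ α : Fin 3 → Fin 3 → ℝ, (∀ i, norm3 (α i) = 1) ∧ x = f3Val ρ α}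

/-- Partial trace over Bob (second factor). -/
def trB (M : Mat4) : Mat2 := Matrix.of fun i j => ∑ k, M (i, k) (j, k)
/-- Partial trace over Alice (first factor). -/
def trA (M : Mat4) : Mat2 := Matrix.of fun i j => ∑ k, M (k, i) (k, j)

/-- The vector |φ⁺(θ)⟩ = cosθ|00⟩ + sinθ|11⟩. -/
def phiVec (θ : ℝ) : Fin 2 × Fin 2 → ℂ :=
  fun q => if q = (0, 0) then (Real.cos θ : ℂ) else if q = (1, 1) then (Real.sin θ : ℂ) else 0

/-- The projector φ⁺(θ) = |φ⁺(θ)⟩⟨φ⁺(θ)|. -/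
def phiProj (θ : ℝ) : Mat4 := vecMulVec (phiVec θ) (star (phiVec θ))

/-- ρ_A(θ) = tr_B φ⁺(θ) = diag(cos²θ, sin²θ). -/
def rhoA (θ : ℝ) : Mat2 := !![(Real.cos θ : ℂ) ^ 2, 0; 0, (Real.sin θ : ℂ) ^ 2]

/-- Partially entangled state with one-sided coloured noise. -/
def rhoM (θ p : ℝ) : Mat4 :=
  (p : ℂ) • phiProj θ + ((1 - p : ℝ) : ℂ) • (rhoA θ ⊗ₖ ((1 / 2 : ℂ) • (1 : Mat2)))

/-- Partially entangled state with symmetric coloured noise. -/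
def rhoMM (θ p : ℝ) : Mat4 :=
  (p : ℂ) • phiProj θ + ((1 - p : ℝ) : ℂ) • (rhoA θ ⊗ₖ rhoA θ)

/-- The vector |Φ⁺⟩ = (|00⟩+|11⟩)/√2. -/
def maxEntVec : Fin 2 × Fin 2 → ℂ :=
  fun q => if q.1 = q.2 then ((Real.sqrt 2 : ℂ))⁻¹ else 0

/-- The projector Φ⁺ = |Φ⁺⟩⟨Φ⁺|. -/
def maxEntProj : Mat4 := vecMulVec maxEntVec (star maxEntVec)

/-- The singlet vector |Ψ⁻⟩ = (|01⟩−|10⟩)/√2. -/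
def singletVec : Fin 2 × Fin 2 → ℂ :=
  fun q => if q = (0, 1) then ((Real.sqrt 2 : ℂ))⁻¹
    else if q = (1, 0) then -((Real.sqrt 2 : ℂ))⁻¹ else 0

/-- The singlet projector |Ψ⁻⟩⟨Ψ⁻|. -/
def singletProj : Mat4 := vecMulVec singletVec (star singletVec)

/-- The vector |00⟩. -/
def zeroVec : Fin 2 × Fin 2 → ℂ := fun q => if q = (0, 0) then 1 else 0

/-- The quasi-distillable state ρ_QD(p) = p|Ψ⁻⟩⟨Ψ⁻| + (1−p)|00⟩⟨00|. -/
def rhoQD (p : ℝ) : Mat4 :=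
  (p : ℂ) • singletProj + ((1 - p : ℝ) : ℂ) • vecMulVec zeroVec (star zeroVec)

/-- The exchange of the two qubits. -/
def swapState (σ : Mat4) : Mat4 := σ.submatrix Prod.swap Prod.swap

lemma trace_kronecker_mul_swapState (X Y : Mat2) (σ : Mat4) :
    ((X ⊗ₖ Y) * swapState σ).trace = ((Y ⊗ₖ X) * σ).trace := by
  simp only [swapState, Matrix.trace, Matrix.diag, Matrix.mul_apply, Matrix.kroneckerMap_apply,
    Matrix.submatrix_apply, Fintype.sum_prod_type, Fin.sum_univ_two, Prod.swap_prod_mk]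
  ring

lemma bVec_swapState (σ : Mat4) : bVec (swapState σ) = aVec σ := by
  funext i
  simp only [aVec, bVec, trace_kronecker_mul_swapState]

lemma aVec_swapState (σ : Mat4) : aVec (swapState σ) = bVec σ := by
  funext i
  simp only [aVec, bVec, trace_kronecker_mul_swapState]

lemma Tmat_swapState (σ : Mat4) : Tmat (swapState σ) = (Tmat σ)ᵀ := by
  ext i j
  simp only [Tmat, Matrix.of_apply, Matrix.transpose_apply, trace_kronecker_mul_swapState]

lemma cA_swapState (σ : Mat4) : cA (swapState σ) = cB σ := by
  simp only [cA, cB, aVec_swapState, bVec_swapState, Tmat_swapState]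

lemma IsState.swapState {σ : Mat4} (h : IsState σ) : IsState (swapState σ) := by
  refine ⟨h.1.submatrix _, ?_⟩
  rw [← h.2]
  simp only [_root_.swapState, Matrix.trace, Matrix.diag, Matrix.submatrix_apply,
    Fintype.sum_prod_type, Fin.sum_univ_two, Prod.swap_prod_mk]
  ring

lemma swapState_rhoQD (p : ℝ) : swapState (rhoQD p) = rhoQD p := by
  ext ⟨i, j⟩ ⟨k, l⟩
  fin_cases i <;> fin_cases j <;> fin_cases k <;> fin_cases l <;>
    simp [swapState, rhoQD, singletProj, singletVec, zeroVec, vecMulVec_apply]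

lemma filterB_swapState (σ : Mat4) (f : Mat2) :
    filterB (swapState σ) f = swapState (filterA σ f) := by
  have hmul (A B : Mat4) : swapState (A * B) = swapState A * swapState B :=
    (Matrix.submatrix_mul_equiv A B Prod.swap (Equiv.prodComm _ _) Prod.swap).symm
  have hkron (X Y : Mat2) : swapState (X ⊗ₖ Y) = Y ⊗ₖ X := by
    ext ⟨i, j⟩ ⟨k, l⟩
    simp [swapState, mul_comm]
  have hstar (A : Mat4) : swapState Aᴴ = (swapState A)ᴴ := rfl
  have hsmul (c : ℂ) (A : Mat4) : swapState (c • A) = c • swapState A := rfl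
  simp only [filterA, filterB, trace_kronecker_mul_swapState, hsmul, hmul, hstar, hkron]

lemma trace_kronecker_mul_filterA (ρ : Mat4) (f X Y : Mat2) :
    ((X ⊗ₖ Y) * filterA ρ f).trace =
      ((((fᴴ * f) ⊗ₖ (1 : Mat2)) * ρ).trace)⁻¹ * (((fᴴ * X * f) ⊗ₖ Y) * ρ).trace := by
  have h : (fᴴ * X * f) ⊗ₖ Y = (f ⊗ₖ (1 : Mat2))ᴴ * ((X ⊗ₖ Y) * (f ⊗ₖ (1 : Mat2))) := by
    rw [conjTranspose_kronecker, conjTranspose_one, ← mul_kronecker_mul, ← mul_kronecker_mul,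
      mul_one, one_mul, mul_assoc]
  rw [filterA, mul_smul_comm, trace_smul, smul_eq_mul, h, Matrix.mul_assoc _ᴴ,
    trace_mul_comm (f ⊗ₖ (1 : Mat2))ᴴ]
  simp only [Matrix.mul_assoc]

lemma isState_filterA {ρ : Mat4} (hρ : ρ.PosSemidef) {f : Mat2}
    (hf : (((fᴴ * f) ⊗ₖ (1 : Mat2)) * ρ).trace ≠ 0) : IsState (filterA ρ f) := by
  have hM := hρ.mul_mul_conjTranspose_same (f ⊗ₖ (1 : Mat2))
  have htr : ((f ⊗ₖ (1 : Mat2)) * ρ * (f ⊗ₖ (1 : Mat2))ᴴ).trace =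
      (((fᴴ * f) ⊗ₖ (1 : Mat2)) * ρ).trace := by
    rw [trace_mul_comm, ← Matrix.mul_assoc, conjTranspose_kronecker, ← mul_kronecker_mul,
      conjTranspose_one, mul_one]
  refine ⟨hM.smul (inv_nonneg.2 (htr ▸ hM.trace_nonneg)), ?_⟩
  rw [filterA, trace_smul, htr, smul_eq_mul, inv_mul_cancel₀ hf]

lemma posSemidef_rhoQD {p : ℝ} (hp₀ : 0 ≤ p) (hp₁ : p ≤ 1) : (rhoQD p).PosSemidef :=
  ((posSemidef_vecMulVec_self_star _).smul (by exact_mod_cast hp₀)).add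
    ((posSemidef_vecMulVec_self_star _).smul (by exact_mod_cast sub_nonneg.2 hp₁))

lemma trace_kronecker_mul_rhoQD (p : ℝ) (X Y : Mat2) :
    ((X ⊗ₖ Y) * rhoQD p).trace = (1 - p) * (X 0 0 * Y 0 0) +
      p / 2 * (X 0 0 * Y 1 1 + X 1 1 * Y 0 0 - X 0 1 * Y 1 0 - X 1 0 * Y 0 1) := by
  have h : ((Real.sqrt 2 : ℂ))⁻¹ * ((Real.sqrt 2 : ℂ))⁻¹ = 1 / 2 := by
    rw [← mul_inv, ← Complex.ofReal_mul, Real.mul_self_sqrt (by norm_num)]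
    norm_num
  simp [rhoQD, singletProj, singletVec, zeroVec, Matrix.trace, Matrix.mul_apply,
    vecMulVec_apply, Fintype.sum_prod_type]
  linear_combination (p : ℂ) * (X 0 0 * Y 1 1 + X 1 1 * Y 0 0 - X 0 1 * Y 1 0 - X 1 0 * Y 0 1) * h

/-- The success probability of the filter `f` on Alice's side of `rhoQD p`. -/
def successProb (p : ℝ) (f : Mat2) : ℝ :=
  (1 - p / 2) * (normSq (f 0 0) + normSq (f 1 0)) + p / 2 * (normSq (f 0 1) + normSq (f 1 1))

lemma trace_filterA_rhoQD (p : ℝ) (f : Mat2) :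
    (((fᴴ * f) ⊗ₖ (1 : Mat2)) * rhoQD p).trace = successProb p f := by
  rw [trace_kronecker_mul_rhoQD]
  simp [Matrix.mul_apply, Fin.sum_univ_two, successProb, normSq_eq_conj_mul_self]
  ring

lemma successProb_pos {p : ℝ} (hp₀ : 0 < p) (hp₁ : p < 2) {f : Mat2} (hf : f ≠ 0) :
    0 < successProb p f := by
  have h1 : 0 < 1 - p / 2 := by linarith
  have h (i j) := normSq_nonneg (f i j)
  obtain ⟨i, j, hij⟩ : ∃ i j, f i j ≠ 0 := by
    by_contra! h0
    exact hf (Matrix.ext h0)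
  have hpos := normSq_pos.2 hij
  have := h 0 0
  have := h 0 1
  have := h 1 0
  have := h 1 1
  unfold successProb
  fin_cases i <;> fin_cases j <;> simp only [Fin.zero_eta, Fin.mk_one] at hpos <;> positivity

/-- The centre of Bob's steering ellipsoid is unaffected by Alice's filters. -/
lemma cB_filterA_rhoQD_two {p : ℝ} (hp₀ : 0 < p) (hp₁ : p < 2) {f : Mat2} (hf : f ≠ 0)
    (ha : norm3 (aVec (filterA (rhoQD p) f)) < 1) :
    cB (filterA (rhoQD p) f) 2 = 2 * (1 - p) / (2 - p) := by
  have hN := successProb_pos hp₀ hp₁ hf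
  have hnorm : norm3 (aVec (filterA (rhoQD p) f)) ^ 2 =
      ∑ i, aVec (filterA (rhoQD p) f) i ^ 2 :=
    Real.sq_sqrt (Finset.sum_nonneg fun i _ => sq_nonneg _)
  have hlt : 0 < 1 - norm3 (aVec (filterA (rhoQD p) f)) ^ 2 := by
    have : 0 ≤ norm3 (aVec (filterA (rhoQD p) f)) := Real.sqrt_nonneg _
    nlinarith
  have h2 : 2 - p ≠ 0 := by linarith
  have hSN : (successProb p f)⁻¹ * successProb p f = 1 := inv_mul_cancel₀ hN.ne'
  have htr (X Y : Mat2) : ((X ⊗ₖ Y) * filterA (rhoQD p) f).trace.re =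
      (successProb p f)⁻¹ * (((fᴴ * X * f) ⊗ₖ Y) * rhoQD p).trace.re := by
    rw [trace_kronecker_mul_filterA, trace_filterA_rhoQD, ← Complex.ofReal_inv, re_ofReal_mul]
  rw [cB, Pi.smul_apply, smul_eq_mul, inv_mul_eq_div, div_eq_div_iff hlt.ne' h2, hnorm]
  simp only [Pi.sub_apply, Matrix.mulVec, dotProduct, Matrix.transpose_apply, Tmat,
    Matrix.of_apply, aVec, bVec, htr, trace_kronecker_mul_rhoQD, Fin.sum_univ_three]
  generalize (successProb p f)⁻¹ = S at hSN ⊢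
  simp [pauli, Matrix.mul_apply, Fin.sum_univ_two]
  linear_combination (norm := skip)
    (2 * (1 - p) * (1 + S * successProb p f) - S * (2 - p) *
      ((1 - p) * (normSq (f 0 0) + normSq (f 1 0)) +
        p / 2 * (normSq (f 0 1) + normSq (f 1 1) - normSq (f 0 0) - normSq (f 1 0)))) * hSN
  simp only [successProb, normSq_apply]
  ring

lemma half_lt_norm3_cB_filterA_rhoQD {p : ℝ} (hp₀ : 0 < p) (hp₁ : p < 2 / 3) {f : Mat2}
    (hf : f ≠ 0) (ha : norm3 (aVec (filterA (rhoQD p) f)) < 1) :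
    1 / 2 < norm3 (cB (filterA (rhoQD p) f)) := by
  have hc := cB_filterA_rhoQD_two hp₀ (by linarith) hf ha
  have hgt : 1 / 2 < cB (filterA (rhoQD p) f) 2 := by
    rw [hc, div_lt_div_iff₀ (by norm_num) (by linarith)]
    linarith
  refine hgt.trans_le (Real.le_sqrt_of_sq_le ?_)
  exact Finset.single_le_sum (f := fun i => cB (filterA (rhoQD p) f) i ^ 2)
    (fun i _ => sq_nonneg _) (Finset.mem_univ 2)

/-- AB-inaccessible maximal hidden CHSH for quasi-distillable states,
conditional on the QSE conjecture: for 0 < p < 2/3, neither Alice nor Bob acting alone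
can reveal any CHSH-inequality violation from ρ_QD(p). -/
theorem stmt_19
    (conjA : ∀ σ : Mat4, IsState σ → norm3 (bVec σ) < 1 → 1 / 2 < norm3 (cA σ) →
      Bval σ ≤ 1)
    (conjB : ∀ σ : Mat4, IsState σ → norm3 (aVec σ) < 1 → 1 / 2 < norm3 (cB σ) →
      Bval σ ≤ 1)
    (p : ℝ) (hp₀ : 0 < p) (hp₁ : p < 2 / 3) :
    (∀ fA : Mat2, IsUnit fA → norm3 (aVec (filterA (rhoQD p) fA)) < 1 →
      Bval (filterA (rhoQD p) fA) ≤ 1) ∧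
    (∀ fB : Mat2, IsUnit fB → norm3 (bVec (filterB (rhoQD p) fB)) < 1 →
      Bval (filterB (rhoQD p) fB) ≤ 1) := by
  have hstate {f : Mat2} (hf : f ≠ 0) : IsState (filterA (rhoQD p) f) := by
    refine isState_filterA (posSemidef_rhoQD hp₀.le (by linarith)) ?_
    rw [trace_filterA_rhoQD]
    exact_mod_cast (successProb_pos hp₀ (by linarith) hf).ne'
  refine ⟨fun f hf ha => ?_, fun f hf hb => ?_⟩
  · exact conjB _ (hstate hf.ne_zero) ha
      (half_lt_norm3_cB_filterA_rhoQD hp₀ hp₁ hf.ne_zero ha)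
  · rw [← swapState_rhoQD, filterB_swapState] at hb ⊢
    rw [bVec_swapState] at hb
    refine conjA _ (hstate hf.ne_zero).swapState ?_ ?_
    · rwa [bVec_swapState]
    · rw [cA_swapState]
      exact half_lt_norm3_cB_filterA_rhoQD hp₀ hp₁ hf.ne_zero hb

end
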